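/- arXiv:1910.06509 — 5 statements merged into one kernel-verified Lean document; each statement's English description precedes it below -/
import Mathlib

section
/- Fix a total number of vertices N. For complete bipartite graphs K_{m,n} with m + n = N and m, n ≥ 1, the entropy H(K_{m,n}) is strictly decreasing in |m − n|: if m + n = m' + n' = N and |m − n| < |m' − n'| with m, n, m', n' ≥ 1, then H(K_{m,n}) > H(K_{m',n'}). -/
open Finset

/-- Number of connected components of the subgraph of `G` induced on the finite
vertex set `C` (this is `0` when `C = ∅`). -/
noncomputable def betti {V : Type*} (G : SimpleGraph V) (C : Finset V) : ℕ :=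
  Nat.card ((SimpleGraph.induce (↑C : Set V) G).ConnectedComponent)

/-- The Shapley influence value
`s(v) = Σ_{C ⊆ V∖{v}} (|C|!·(n−|C|−1)!/n!)·|β(C∪{v}) − β(C)|`. -/
noncomputable def shapley {V : Type*} [Fintype V] [DecidableEq V]
    (G : SimpleGraph V) (v : V) : ℝ :=
  ∑ C ∈ (Finset.univ.erase v).powerset,
    ((C.card.factorial : ℝ) * ((Fintype.card V - C.card - 1).factorial : ℝ)
        / ((Fintype.card V).factorial : ℝ)) *
      |((betti G (insert v C) : ℝ)) - ((betti G C : ℝ))|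

/-- Normalized influence score `μ(v) = s(v) / Σ_u s(u)`. -/
noncomputable def influence {V : Type*} [Fintype V] [DecidableEq V]
    (G : SimpleGraph V) (v : V) : ℝ :=
  shapley G v / ∑ u : V, shapley G u

/-- Entropy `H(G) = −Σ_v μ(v)·log μ(v)`. -/
noncomputable def graphEntropy {V : Type*} [Fintype V] [DecidableEq V]
    (G : SimpleGraph V) : ℝ :=
  -∑ v : V, influence G v * Real.log (influence G v)

/-! ### Binary relative entropy -/

/-- Relative entropy of a Bernoulli law of parameter `p` with respect to one of parameter `r`. -/
noncomputable def binRelEntropy (p r : ℝ) : ℝ :=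
  p * Real.log (p / r) + (1 - p) * Real.log ((1 - p) / (1 - r))

lemma sub_lt_mul_log_div {p r : ℝ} (hp : 0 < p) (hr : 0 < r) (h : p ≠ r) :
    p - r < p * Real.log (p / r) := by
  have h1 := Real.log_lt_sub_one_of_pos (div_pos hr hp)
    (fun e ↦ h ((div_eq_one_iff_eq hp.ne').1 e).symm)
  rw [← inv_div p r, Real.log_inv] at h1
  have h2 := mul_lt_mul_of_pos_left h1 hp
  have h3 : p * ((p / r)⁻¹ - 1) = r - p := by field_simp
  linarith

lemma binRelEntropy_pos {p r : ℝ} (hp : 0 < p) (hp' : p < 1) (hr : 0 < r) (hr' : r < 1)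
    (h : p ≠ r) : 0 < binRelEntropy p r := by
  have h1 := sub_lt_mul_log_div hp hr h
  have h2 := sub_lt_mul_log_div (sub_pos.2 hp') (sub_pos.2 hr') (fun e ↦ h (by linarith))
  rw [binRelEntropy]
  linarith

/-- An instance of the log sum inequality. -/
lemma add_mul_log_add_div_add_le {p r t b : ℝ} (hp : 0 < p) (hr : 0 < r) (ht : 0 ≤ t)
    (hb : 0 ≤ b) (h : 0 < t * r + b) :
    (t * p + b) * Real.log ((t * p + b) / (t * r + b)) ≤ t * (p * Real.log (p / r)) := by
  have key := Real.convexOn_mul_log.2 (Set.mem_Ici.2 (div_pos hp hr).le)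
    (Set.mem_Ici.2 zero_le_one) (div_nonneg (mul_nonneg ht hr.le) h.le) (div_nonneg hb h.le)
    (by field_simp)
  simp only [smul_eq_mul, Real.log_one, mul_zero, add_zero, mul_one] at key
  have e1 : t * r / (t * r + b) * (p / r) + b / (t * r + b) = (t * p + b) / (t * r + b) := by
    field_simp
  have e2 : t * r / (t * r + b) * (p / r * Real.log (p / r))
      = t * (p * Real.log (p / r)) / (t * r + b) := by
    field_simp
  rw [e1, e2, div_mul_eq_mul_div] at key
  exact (div_le_div_iff_of_pos_right h).1 key

lemma binRelEntropy_lt {p r q s t : ℝ} (hr : 0 < r) (hr' : r < 1)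
    (hq : 0 < q) (hq' : q < 1) (hs : 0 < s) (hs' : s < 1) (hqs : q ≠ s) (ht : 0 ≤ t) (ht' : t < 1)
    (h : p - r = t * (q - s)) (h0 : t * s ≤ r) (h1 : t * (1 - s) ≤ 1 - r) :
    binRelEntropy p r < binRelEntropy q s := by
  have a1 := add_mul_log_add_div_add_le hq hs ht (sub_nonneg.2 h0) (by linarith)
  have a2 := add_mul_log_add_div_add_le (sub_pos.2 hq') (sub_pos.2 hs') ht (sub_nonneg.2 h1)
    (by linarith)
  rw [show t * q + (r - t * s) = p by linarith, show t * s + (r - t * s) = r by ring] at a1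
  rw [show t * (1 - q) + (1 - r - t * (1 - s)) = 1 - p by linarith,
    show t * (1 - s) + (1 - r - t * (1 - s)) = 1 - r by ring] at a2
  have := mul_lt_mul_of_pos_right ht' (binRelEntropy_pos hq hq' hs hs' hqs)
  rw [one_mul] at this
  refine lt_of_le_of_lt ?_ this
  rw [binRelEntropy, binRelEntropy]
  linarith

/-! ### Monotonicity in the imbalance -/

/-- The total Shapley influence of the complete bipartite graph with sides of sizes `m`, `n`. -/
noncomputable def totalInfluence (m n : ℝ) : ℝ :=
  2 * m / (n + 1) + 2 * n / (m + 1) - 1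

/-- The total influence score of the side of size `m`. -/
noncomputable def sideInfluence (m n : ℝ) : ℝ :=
  1 / 2 + (m - n) / (2 * (m + n) * totalInfluence m n)

lemma totalInfluence_eq {m n : ℝ} (hm : 1 ≤ m) (hn : 1 ≤ n) :
    totalInfluence m n
      = 2 * ((m + n) ^ 2 - 2 * (m * n) + (m + n)) / (m * n + (m + n) + 1) - 1 := by
  have h1 : m + 1 ≠ 0 := by linarith
  have h2 : n + 1 ≠ 0 := by linarith
  rw [totalInfluence, show m * n + (m + n) + 1 = (m + 1) * (n + 1) by ring]
  field_simp
  ring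

lemma one_le_totalInfluence {m n : ℝ} (hm : 1 ≤ m) (hn : 1 ≤ n) : 1 ≤ totalInfluence m n := by
  have h : 0 < m * n + (m + n) + 1 := by positivity
  rw [totalInfluence_eq hm hn, le_sub_iff_add_le, le_div_iff₀ h]
  nlinarith [sq_nonneg (m - n), mul_nonneg (sub_nonneg.2 hm) (sub_nonneg.2 hn)]

lemma one_lt_totalInfluence {m n : ℝ} (hm : 1 ≤ m) (hn : 1 ≤ n) (h2 : 2 < m + n) :
    1 < totalInfluence m n := by
  have h : 0 < m * n + (m + n) + 1 := by positivity
  rw [totalInfluence_eq hm hn, lt_sub_iff_add_lt, lt_div_iff₀ h]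
  nlinarith [sq_nonneg (m - n), mul_nonneg (sub_nonneg.2 hm) (sub_nonneg.2 hn)]

lemma totalInfluence_le {m n m' n' : ℝ} (hm : 1 ≤ m) (hn : 1 ≤ n) (hm' : 1 ≤ m') (hn' : 1 ≤ n')
    (hN : m + n = m' + n') (h : m' * n' ≤ m * n) :
    totalInfluence m n ≤ totalInfluence m' n' := by
  rw [totalInfluence_eq hm hn, totalInfluence_eq hm' hn', hN]
  have : 0 < m' * n' + (m' + n') + 1 := by positivity
  have h4 : 4 * (m * n) ≤ (m' + n') ^ 2 := by rw [← hN]; nlinarith [sq_nonneg (m - n)]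
  gcongr 2 * ?_ / ?_ - 1
  · nlinarith
  · linarith
  · linarith

lemma sideInfluence_pos {m n : ℝ} (hm : 1 ≤ m) (hn : 1 ≤ n) : 0 < sideInfluence m n := by
  have hT := one_le_totalInfluence hm hn
  have h : 0 < 2 * (m + n) * totalInfluence m n := by positivity
  have : -(1 / 2) < (m - n) / (2 * (m + n) * totalInfluence m n) := by
    rw [lt_div_iff₀ h]
    nlinarith [mul_nonneg (by linarith : 0 ≤ m + n) (sub_nonneg.2 hT)]
  rw [sideInfluence]
  linarith

lemma totalInfluence_comm (m n : ℝ) : totalInfluence m n = totalInfluence n m := by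
  rw [totalInfluence, totalInfluence]; ring

lemma sideInfluence_swap (m n : ℝ) : sideInfluence n m = 1 - sideInfluence m n := by
  rw [sideInfluence, sideInfluence, totalInfluence_comm n m, add_comm n m, ← neg_sub m n]
  ring

lemma binRelEntropy_sideInfluence_lt {m n m' n' : ℝ} (hm : 1 ≤ m) (hn : 1 ≤ n) (hm' : 1 ≤ m')
    (hn' : 1 ≤ n') (hN : m + n = m' + n') (hmn : n ≤ m) (h : m - n < m' - n') :
    binRelEntropy (sideInfluence m n) (m / (m + n))
      < binRelEntropy (sideInfluence m' n') (m' / (m' + n')) := by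
  have hT := one_lt_totalInfluence hm hn (by linarith)
  have hTT := totalInfluence_le hm hn hm' hn' hN (by nlinarith)
  have hq := sideInfluence_pos hm' hn'
  have hq' := sideInfluence_pos hn' hm'
  rw [sideInfluence_swap] at hq'
  have hS : 0 < m' + n' := by linarith
  have e : ∀ a b : ℝ, a + b = m' + n' → 0 < totalInfluence a b →
      a / (m' + n') - sideInfluence a b
        = (a - b) / (2 * (m' + n')) * (1 - 1 / totalInfluence a b) := fun a b hab hT ↦ by
    rw [sideInfluence, hab]
    have : a / (m' + n') = 1 / 2 + (a - b) / (2 * (m' + n')) := by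
      field_simp
      linarith
    rw [this]
    field_simp
    ring
  have e1 := e m n hN (by linarith)
  have e2 := e m' n' rfl (by linarith)
  rw [hN]
  set T := totalInfluence m n
  set T' := totalInfluence m' n'
  set x := (m - n) / (2 * (m' + n')) with hx
  set x' := (m' - n') / (2 * (m' + n')) with hx'
  have r1 : m / (m' + n') = 1 / 2 + x := by rw [hx]; field_simp; linarith
  have r2 : m' / (m' + n') = 1 / 2 + x' := by rw [hx']; field_simp; ring
  have x0 : 0 ≤ x := div_nonneg (by linarith) (by linarith)
  have xx : x < x' := by rw [hx, hx']; gcongr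
  have x1 : x' < 1 / 2 := by rw [hx', div_lt_iff₀ (by linarith)]; linarith
  have d0 : 0 < 1 - 1 / T := by
    rw [sub_pos, div_lt_one (by linarith)]; exact hT
  have dd : 1 - 1 / T ≤ 1 - 1 / T' := by gcongr
  set d := 1 - 1 / T
  set d' := 1 - 1 / T'
  have x0' : 0 < x' := by linarith
  have d0' : 0 < d' := by linarith
  have hpos : 0 < x' * d' := by positivity
  have ht : x * d / (x' * d') ≤ x / x' := by
    rw [div_le_div_iff₀ hpos x0']
    have : x * x' * d ≤ x * x' * d' := by gcongr
    linarith
  have hxx1 : x / x' < 1 := by rwa [div_lt_one x0']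
  have ht0 : 0 ≤ x * d / (x' * d') := by positivity
  have hsub : x * d / (x' * d') * x' ≤ x := by
    rwa [← le_div_iff₀ x0']
  have hsub' : x - x * d / (x' * d') * x' ≤ 1 / 2 * (1 - x * d / (x' * d')) := by
    nlinarith
  apply binRelEntropy_lt (t := x * d / (x' * d')) <;> try rw [r1]
  all_goals try rw [r2]
  · linarith
  · linarith
  · exact hq
  · linarith
  · linarith
  · linarith
  · intro hc; rw [hc, r2] at e2; linarith
  · exact ht0
  · linarith
  · rw [← r1, ← r2, ← neg_sub, e1, ← neg_sub (m' / _), e2]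
    field_simp
  · linarith
  · linarith

/-! ### Shapley weights -/

/-- The Shapley weight of a coalition of size `k` among `N` players. -/
noncomputable def shapleyWeight (N k : ℕ) : ℝ :=
  (k.factorial : ℝ) * ((N - k - 1).factorial : ℝ) / (N.factorial : ℝ)

lemma shapleyWeight_zero {N : ℕ} (hN : 0 < N) : shapleyWeight N 0 = 1 / N := by
  obtain ⟨M, rfl⟩ := Nat.exists_eq_add_of_lt hN
  have : (M.factorial : ℝ) ≠ 0 := by positivity
  simp only [shapleyWeight, zero_add, Nat.factorial_succ, Nat.add_sub_cancel, Nat.sub_zero,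
    Nat.factorial_zero]
  push_cast
  field_simp

lemma shapleyWeight_add_succ {N k : ℕ} (h : k + 1 ≤ N) :
    shapleyWeight (N + 1) k + shapleyWeight (N + 1) (k + 1) = shapleyWeight N k := by
  obtain ⟨i, rfl⟩ := Nat.exists_eq_add_of_le h
  have h1 : k + 1 + i + 1 - k - 1 = i + 1 := by omega
  have h2 : k + 1 + i + 1 - (k + 1) - 1 = i := by omega
  have h3 : k + 1 + i - k - 1 = i := by omega
  have : ((k + 1 + i).factorial : ℝ) ≠ 0 := by positivity
  simp only [shapleyWeight, h1, h2, h3, Nat.factorial_succ (k + 1 + i), Nat.factorial_succ k,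
    Nat.factorial_succ i]
  push_cast
  field_simp
  ring

lemma sum_shapleyWeight {V : Type*} [DecidableEq V] (s : Finset V) {N : ℕ} (h : s.card < N) :
    ∑ C ∈ s.powerset, shapleyWeight N C.card = 1 / ((N : ℝ) - s.card) := by
  induction s using Finset.induction_on generalizing N with
  | empty => simpa using shapleyWeight_zero h
  | insert a s ha ih =>
    rw [card_insert_of_notMem ha] at h ⊢
    obtain ⟨M, rfl⟩ : ∃ M, N = M + 1 := ⟨N - 1, by omega⟩
    rw [sum_powerset_insert ha, ← sum_add_distrib]
    have key : ∀ C ∈ s.powerset, shapleyWeight (M + 1) C.card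
        + shapleyWeight (M + 1) (insert a C).card = shapleyWeight M C.card := fun C hC ↦ by
      have hCs := mem_powerset.1 hC
      rw [card_insert_of_notMem fun h ↦ ha (hCs h)]
      exact shapleyWeight_add_succ (by have := card_le_card hCs; omega)
    rw [sum_congr rfl key, ih (by omega)]
    push_cast
    ring

lemma sum_card_mul_shapleyWeight {V : Type*} [DecidableEq V] (s : Finset V) {N : ℕ}
    (h : s.card < N) :
    ∑ C ∈ s.powerset, (C.card : ℝ) * shapleyWeight N C.card
      = s.card / (((N : ℝ) - s.card) * (N - s.card + 1)) := by
  induction s using Finset.induction_on generalizing N with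
  | empty => simp
  | insert a s ha ih =>
    have hN := sum_shapleyWeight _ h
    rw [card_insert_of_notMem ha] at h hN ⊢
    have hs : s.card < N := by omega
    rw [sum_powerset_insert ha, sum_shapleyWeight s hs] at hN
    obtain ⟨M, rfl⟩ : ∃ M, N = M + 1 := ⟨N - 1, by omega⟩
    rw [sum_powerset_insert ha, ← sum_add_distrib]
    have key : ∀ C ∈ s.powerset, (C.card : ℝ) * shapleyWeight (M + 1) C.card
        + ((insert a C).card : ℝ) * shapleyWeight (M + 1) (insert a C).card
        = C.card * shapleyWeight M C.card + shapleyWeight (M + 1) (insert a C).card :=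
      fun C hC ↦ by
        have hCs := mem_powerset.1 hC
        rw [card_insert_of_notMem fun h ↦ ha (hCs h),
          ← shapleyWeight_add_succ (N := M) (k := C.card)
            (by have := card_le_card hCs; omega)]
        push_cast
        ring
    rw [sum_congr rfl key, sum_add_distrib, ih (by omega), eq_sub_of_add_eq' hN]
    have hM : (s.card : ℝ) + 1 ≤ M := by exact_mod_cast (by omega : s.card + 1 ≤ M)
    have h1 : (M : ℝ) - s.card ≠ 0 := by linarith
    have h2 : (M : ℝ) - s.card + 1 ≠ 0 := by linarith
    push_cast
    rw [show (M : ℝ) + 1 - (s.card + 1) = M - s.card by ring,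
      show (M : ℝ) + 1 - s.card = M - s.card + 1 by ring]
    field_simp
    ring

/-! ### Components of induced subgraphs of a complete bipartite graph -/

lemma betti_of_not_adj {V : Type*} (G : SimpleGraph V) (C : Finset V)
    (h : ∀ x ∈ C, ∀ y ∈ C, ¬ G.Adj x y) : betti G C = C.card := by
  have hbot : G.induce (C : Set V) = ⊥ := by
    ext x y
    simpa using h x x.2 y y.2
  have hbij : Function.Bijective (⊥ : SimpleGraph (C : Set V)).connectedComponentMk :=
    ⟨fun x y hxy ↦ SimpleGraph.reachable_bot.1 (SimpleGraph.ConnectedComponent.exact hxy),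
      Quot.mk_surjective⟩
  rw [betti, hbot, ← Nat.card_eq_of_bijective _ hbij]
  simp

lemma betti_of_connected {V : Type*} (G : SimpleGraph V) (C : Finset V)
    (h : (G.induce (C : Set V)).Connected) : betti G C = 1 := by
  have := h.preconnected.subsingleton_connectedComponent
  have := h.nonempty
  exact Nat.card_of_subsingleton
    ((G.induce (C : Set V)).connectedComponentMk (Classical.arbitrary _))

/-- `G` is the complete bipartite graph with sides `A` and `Aᶜ`. -/
def IsCompleteBipartition {V : Type*} (G : SimpleGraph V) (A : Finset V) : Prop :=
  ∀ x y, G.Adj x y ↔ (x ∈ A ↔ y ∉ A)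

namespace IsCompleteBipartition

variable {V : Type*} {G : SimpleGraph V} {A : Finset V}

lemma compl [Fintype V] [DecidableEq V] (hG : IsCompleteBipartition G A) :
    IsCompleteBipartition G Aᶜ := fun x y ↦ by
  rw [hG x y]
  simp only [mem_compl]
  tauto

lemma betti_of_subset (hG : IsCompleteBipartition G A) {C : Finset V} (hC : C ⊆ A) :
    betti G C = C.card :=
  betti_of_not_adj G C fun x hx y hy h ↦ ((hG x y).1 h).1 (hC hx) (hC hy)

lemma betti_of_mem_of_mem (hG : IsCompleteBipartition G A) {C : Finset V} {a b : V}
    (ha : a ∈ C) (hb : b ∈ C) (haA : a ∈ A) (hbA : b ∉ A) : betti G C = 1 := by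
  refine betti_of_connected G C ((SimpleGraph.connected_iff_exists_forall_reachable _).2
    ⟨⟨a, ha⟩, fun ⟨x, hx⟩ ↦ ?_⟩)
  have adj : ∀ y z : (C : Set V), (y.1 ∈ A ↔ z.1 ∉ A) →
      (G.induce (C : Set V)).Reachable y z := fun y z h ↦
    SimpleGraph.Adj.reachable ((hG y z).2 h)
  have hab := adj ⟨a, ha⟩ ⟨b, hb⟩ (by simp [haA, hbA])
  by_cases hxA : x ∈ A
  · exact hab.trans (adj ⟨b, hb⟩ ⟨x, hx⟩ (by simp [hxA, hbA]))
  · exact adj ⟨a, ha⟩ ⟨x, hx⟩ (by simp [hxA, haA])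

variable [Fintype V] [DecidableEq V]

lemma abs_betti_insert_sub (hG : IsCompleteBipartition G A) {v : V} (hv : v ∈ A) {C : Finset V}
    (hvC : v ∉ C) :
    |(betti G (insert v C) : ℝ) - betti G C|
      = (if C ⊆ A then 1 else 0) + (if C ⊆ Aᶜ then (C.card : ℝ) - 1 else 0)
        + (if C = ∅ then 1 else 0) := by
  rcases C.eq_empty_or_nonempty with rfl | ⟨c, hc⟩
  · rw [hG.betti_of_subset (by simpa), hG.betti_of_subset (by simp)]
    simp
  have hne : C ≠ ∅ := ne_empty_of_mem hc
  by_cases hCA : C ⊆ A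
  · have hCA' : ¬ C ⊆ Aᶜ := fun h ↦ mem_compl.1 (h hc) (hCA hc)
    rw [hG.betti_of_subset (insert_subset hv hCA), hG.betti_of_subset hCA,
      card_insert_of_notMem hvC]
    simp [hCA, hCA', hne]
  obtain ⟨b, hb, hbA⟩ := not_subset.1 hCA
  rw [hG.betti_of_mem_of_mem (mem_insert_self v C) (mem_insert_of_mem hb) hv hbA]
  by_cases hCA' : C ⊆ Aᶜ
  · rw [hG.compl.betti_of_subset hCA']
    have : (1 : ℝ) ≤ C.card := by exact_mod_cast card_pos.2 ⟨c, hc⟩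
    simp only [hCA, hCA', hne, if_true, if_false, Nat.cast_one]
    rw [abs_sub_comm, abs_of_nonneg (by linarith)]
    ring
  · obtain ⟨a, ha, haA⟩ := not_subset.1 hCA'
    rw [hG.betti_of_mem_of_mem ha hb (by simpa using haA) hbA]
    simp [hCA, hCA', hne]

lemma shapley_eq (hG : IsCompleteBipartition G A) {v : V} (hv : v ∈ A) :
    shapley G v = 1 / ((Aᶜ.card : ℝ) + 1) + Aᶜ.card / ((A.card : ℝ) * (A.card + 1))
      - 1 / A.card + 1 / ((A.card : ℝ) + Aᶜ.card) := by
  have hcard : Fintype.card V = A.card + Aᶜ.card := (card_add_card_compl A).symm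
  have hA : 0 < A.card := card_pos.2 ⟨v, hv⟩
  have hN : 0 < Fintype.card V := by omega
  have hAe : (A.erase v).card + 1 = A.card := card_erase_add_one hv
  have hvA : v ∉ Aᶜ := by simpa
  have h1 := sum_shapleyWeight (A.erase v) (N := Fintype.card V) (by omega)
  have h2 := sum_shapleyWeight Aᶜ (N := Fintype.card V) (by omega)
  have h3 := sum_card_mul_shapleyWeight Aᶜ (N := Fintype.card V) (by omega)
  have h4 := shapleyWeight_zero hN
  have hAe' : ((A.erase v).card : ℝ) = A.card - 1 := by
    rw [← hAe]; push_cast; ring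
  have key : shapley G v = ∑ C ∈ (A.erase v).powerset, shapleyWeight (Fintype.card V) C.card
      + (∑ C ∈ Aᶜ.powerset, (C.card : ℝ) * shapleyWeight (Fintype.card V) C.card
        - ∑ C ∈ Aᶜ.powerset, shapleyWeight (Fintype.card V) C.card)
      + shapleyWeight (Fintype.card V) 0 := by
    have e1 : (A.erase v).powerset = {C ∈ (univ.erase v).powerset | C ⊆ A} := by
      ext C; simp [subset_erase, and_comm]
    have e2 : Aᶜ.powerset = {C ∈ (univ.erase v).powerset | C ⊆ Aᶜ} := by
      ext C
      simp only [mem_powerset, mem_filter, subset_erase, subset_univ, true_and]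
      exact ⟨fun h ↦ ⟨fun h' ↦ hvA (h h'), h⟩, fun h ↦ h.2⟩
    have e3 : shapleyWeight (Fintype.card V) 0 = ∑ C ∈ (univ.erase v).powerset,
        if C = ∅ then shapleyWeight (Fintype.card V) C.card else 0 := by
      rw [sum_ite_eq' _ (∅ : Finset V)]
      simp
    rw [← sum_sub_distrib, e3, e1, e2, sum_filter, sum_filter, ← sum_add_distrib,
      ← sum_add_distrib]
    refine sum_congr rfl fun C hC ↦ ?_
    have hvC : v ∉ C := (subset_erase.1 (mem_powerset.1 hC)).2
    rw [hG.abs_betti_insert_sub hv hvC, ← shapleyWeight]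
    split_ifs <;> ring
  rw [key, h1, h2, h3, h4, hAe', hcard]
  push_cast
  rw [show (A.card : ℝ) + Aᶜ.card - (A.card - 1) = Aᶜ.card + 1 by ring,
    show (A.card : ℝ) + Aᶜ.card - Aᶜ.card = A.card by ring]
  ring

lemma card_mul_shapley (hG : IsCompleteBipartition G A) {v : V} (hv : v ∈ A) :
    A.card * shapley G v = totalInfluence A.card Aᶜ.card / 2
      + (A.card - Aᶜ.card) / (2 * ((A.card : ℝ) + Aᶜ.card)) := by
  have hA : (0 : ℝ) < A.card := by exact_mod_cast card_pos.2 ⟨v, hv⟩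
  rw [hG.shapley_eq hv, totalInfluence]
  field_simp
  ring

lemma sum_shapley_side (hG : IsCompleteBipartition G A) (hA : 1 ≤ A.card) :
    ∑ v ∈ A, shapley G v = totalInfluence A.card Aᶜ.card / 2
      + (A.card - Aᶜ.card) / (2 * ((A.card : ℝ) + Aᶜ.card)) := by
  obtain ⟨a, ha⟩ := card_pos.1 hA
  rw [← hG.card_mul_shapley ha, sum_congr rfl fun v hv ↦
    (hG.shapley_eq hv).trans (hG.shapley_eq ha).symm]
  simp

lemma sum_shapley (hG : IsCompleteBipartition G A) (hA : 1 ≤ A.card) (hA' : 1 ≤ Aᶜ.card) :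
    ∑ v, shapley G v = totalInfluence A.card Aᶜ.card := by
  have h := hG.compl.sum_shapley_side hA'
  rw [compl_compl, totalInfluence_comm, add_comm (Aᶜ.card : ℝ) A.card,
    ← neg_sub (A.card : ℝ)] at h
  rw [← sum_add_sum_compl A, hG.sum_shapley_side hA, h]
  ring

lemma influence_eq (hG : IsCompleteBipartition G A) (hA' : 1 ≤ Aᶜ.card) {v : V} (hv : v ∈ A) :
    influence G v = sideInfluence A.card Aᶜ.card / A.card := by
  have hA : 1 ≤ A.card := card_pos.2 ⟨v, hv⟩
  have hAr : (1 : ℝ) ≤ A.card := by exact_mod_cast hA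
  have hT := one_le_totalInfluence hAr (by exact_mod_cast hA' : (1 : ℝ) ≤ Aᶜ.card)
  have h := hG.card_mul_shapley hv
  rw [influence, hG.sum_shapley hA hA', sideInfluence, div_eq_div_iff (by linarith) (by linarith),
    mul_comm, h]
  field_simp

lemma sum_influence_mul_log (hG : IsCompleteBipartition G A) (hA : 1 ≤ A.card)
    (hA' : 1 ≤ Aᶜ.card) :
    ∑ v ∈ A, influence G v * Real.log (influence G v)
      = sideInfluence A.card Aᶜ.card
        * (Real.log (sideInfluence A.card Aᶜ.card / (A.card / ((A.card : ℝ) + Aᶜ.card)))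
          - Real.log ((A.card : ℝ) + Aᶜ.card)) := by
  have hAr : (1 : ℝ) ≤ A.card := by exact_mod_cast hA
  have hp := sideInfluence_pos hAr (by exact_mod_cast hA' : (1 : ℝ) ≤ Aᶜ.card)
  rw [sum_congr rfl fun v hv ↦ by rw [hG.influence_eq hA' hv], sum_const, nsmul_eq_mul,
    ← Real.log_div (by positivity) (by positivity)]
  field_simp

lemma graphEntropy_eq (hG : IsCompleteBipartition G A) (hA : 1 ≤ A.card) (hA' : 1 ≤ Aᶜ.card) :
    graphEntropy G = Real.log ((A.card : ℝ) + Aᶜ.card)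
      - binRelEntropy (sideInfluence A.card Aᶜ.card) (A.card / ((A.card : ℝ) + Aᶜ.card)) := by
  have h := hG.compl.sum_influence_mul_log hA' (by rwa [compl_compl])
  have hA0 : (0 : ℝ) < A.card := by exact_mod_cast hA
  rw [compl_compl, sideInfluence_swap, add_comm (Aᶜ.card : ℝ) A.card,
    show (Aᶜ.card : ℝ) / (A.card + Aᶜ.card) = 1 - A.card / (A.card + Aᶜ.card) by
      field_simp; ring] at h
  rw [graphEntropy, ← sum_add_sum_compl A, hG.sum_influence_mul_log hA hA', h, binRelEntropy]
  ring

end IsCompleteBipartition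

/-- Some side of `K_{m,n}` has `max m n` vertices, and its complement has `min m n`. -/
lemma exists_isCompleteBipartition_card_eq_max (m n : ℕ) :
    ∃ A : Finset (Fin m ⊕ Fin n),
      IsCompleteBipartition (completeBipartiteGraph (Fin m) (Fin n)) A ∧
        A.card = max m n ∧ Aᶜ.card = min m n := by
  set A : Finset (Fin m ⊕ Fin n) := univ.filter (fun x ↦ x.isLeft) with hA
  have hG : IsCompleteBipartition (completeBipartiteGraph (Fin m) (Fin n)) A := by
    rintro (x | x) (y | y) <;> simp [A]
  have hm : A.card = m := by
    rw [show A = univ.map Function.Embedding.inl by ext (x | x) <;> simp [A]]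
    simp
  have hn : Aᶜ.card = n := by
    rw [card_compl, hm]
    simp
  rcases le_total n m with h | h
  · exact ⟨A, hG, by rw [hm, max_eq_left h], by rw [hn, min_eq_right h]⟩
  · exact ⟨Aᶜ, hG.compl, by rw [hn, max_eq_right h], by rw [compl_compl, hm, min_eq_left h]⟩

/-- For complete bipartite graphs with a fixed total number of vertices, the
entropy `H(K_{m,n})` is strictly decreasing in `|m − n|`. -/
theorem entropy_completeBipartite_decreasing (m n m' n' : ℕ)
    (hm : 1 ≤ m) (hn : 1 ≤ n) (hm' : 1 ≤ m') (hn' : 1 ≤ n')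
    (hN : m + n = m' + n')
    (h : |(m : ℤ) - (n : ℤ)| < |(m' : ℤ) - (n' : ℤ)|) :
    graphEntropy (completeBipartiteGraph (Fin m') (Fin n')) <
      graphEntropy (completeBipartiteGraph (Fin m) (Fin n)) := by
  obtain ⟨A, hG, hA, hAc⟩ := exists_isCompleteBipartition_card_eq_max m n
  obtain ⟨B, hG', hB, hBc⟩ := exists_isCompleteBipartition_card_eq_max m' n'
  rw [hG.graphEntropy_eq (by omega) (by omega), hG'.graphEntropy_eq (by omega) (by omega),
    hA, hAc, hB, hBc]
  have hS : ((max m n : ℕ) : ℝ) + (min m n : ℕ) = (max m' n' : ℕ) + (min m' n' : ℕ) := by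
    exact_mod_cast (by omega : max m n + min m n = max m' n' + min m' n')
  have hd : ((max m n : ℕ) : ℝ) - (min m n : ℕ) < (max m' n' : ℕ) - (min m' n' : ℕ) := by
    exact_mod_cast (by push_cast; simpa only [max_sub_min_eq_abs'] using h :
      ((max m n : ℕ) : ℤ) - (min m n : ℕ) < (max m' n' : ℕ) - (min m' n' : ℕ))
  have := binRelEntropy_sideInfluence_lt (by exact_mod_cast (by omega : 1 ≤ max m n))
    (by exact_mod_cast (by omega : 1 ≤ min m n)) (by exact_mod_cast (by omega : 1 ≤ max m' n'))
    (by exact_mod_cast (by omega : 1 ≤ min m' n')) hS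
    (by exact_mod_cast min_le_max : ((min m n : ℕ) : ℝ) ≤ (max m n : ℕ)) hd
  rw [← hS] at this ⊢
  linarith
end

section
/- For all integers N ≥ 1 and 1 ≤ m ≤ N, it holds that (1/N!)·Σ_{k=0}^{N−m} C(N−m, k)·k!·(N−k−1)! = 1/m, where C(a,b) denotes the binomial coefficient. -/
open Finset

/-- The identity in natural numbers, with the subtractions `N - m` and `m - 1` replaced by free
variables `n` and `p`. -/
theorem succ_mul_sum_choose_mul_factorial_mul_factorial (n p : ℕ) :
    (p + 1) * ∑ k ∈ Finset.range (n + 1), n.choose k * k.factorial * (n + p - k).factorial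
      = (n + p + 1).factorial := by
  induction n with
  | zero => simp [Nat.factorial_succ]
  | succ n ih =>
    have hterm : ∀ k ∈ Finset.range (n + 1),
        (n + 1).choose (k + 1) * (k + 1).factorial * (n + 1 + p - (k + 1)).factorial
          = (n + 1) * (n.choose k * k.factorial * (n + p - k).factorial) := by
      intro k _
      have hsub : n + 1 + p - (k + 1) = n + p - k := by omega
      have hchoose := (Nat.add_one_mul_choose_eq n k).symm
      rw [hsub, Nat.factorial_succ k]
      linear_combination (k.factorial * (n + p - k).factorial) * hchoose
    rw [Finset.sum_range_succ', Finset.sum_congr rfl hterm, ← Finset.mul_sum, mul_add,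
      mul_left_comm, ih, Nat.factorial_succ (n + 1 + p), add_right_comm n 1 p]
    simp only [Nat.choose_zero_right, Nat.factorial_zero, Nat.sub_zero]
    ring

/-- For all integers `N ≥ 1` and `1 ≤ m ≤ N`,
`(1/N!)·Σ_{k=0}^{N−m} C(N−m, k)·k!·(N−k−1)! = 1/m`. -/
theorem sum_factorial_identity_one (N m : ℕ) (hN : 1 ≤ N) (hm : 1 ≤ m) (hmN : m ≤ N) :
    (1 / (N.factorial : ℝ)) *
      ∑ k ∈ Finset.range (N - m + 1),
        ((N - m).choose k : ℝ) * (k.factorial : ℝ) * ((N - k - 1).factorial : ℝ)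
      = 1 / (m : ℝ) := by
  obtain ⟨p, rfl⟩ := Nat.exists_eq_add_of_le' hm
  obtain ⟨n, rfl⟩ := Nat.exists_eq_add_of_le' hmN
  have key := succ_mul_sum_choose_mul_factorial_mul_factorial n p
  have hsub : ∀ k, n + (p + 1) - k - 1 = n + p - k := by intro k; omega
  simp only [Nat.add_sub_cancel, hsub]
  have hfac : ((n + (p + 1)).factorial : ℝ) ≠ 0 := by positivity
  have hp : ((p + 1 : ℕ) : ℝ) ≠ 0 := by positivity
  rw [one_div_mul_eq_div, div_eq_div_iff hfac hp, one_mul, mul_comm]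
  exact_mod_cast key
end

section
/- For all integers m ≥ 0 and n ≥ 1, it holds that (1/(m+n)!)·Σ_{k=2}^{m} C(m, k)·(k−1)·k!·(m+n−k−1)! = m(m−1)/(n(n+1)(m+n)), where C(a,b) denotes the binomial coefficient (the left-hand sum is empty, hence zero, when m < 2). -/
open Finset

/-- Closed form of the partial sums of `(c - j) (p + j)! / j!`, by telescoping. -/
theorem sum_range_sub_mul_factorial_div (p M : ℕ) (c : ℝ) :
    ∑ j ∈ range M, (c - j) * (((p + j).factorial : ℝ) / (j.factorial : ℝ)) =
      M * (((p + M).factorial : ℝ) / (M.factorial : ℝ)) * (c / (p + 1) - (M - 1) / (p + 2)) := by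
  induction M with
  | zero => simp
  | succ M ih =>
    rw [sum_range_succ, ih, ← add_assoc, Nat.factorial_succ, Nat.factorial_succ]
    push_cast
    field_simp
    ring

/-- For all integers `m ≥ 0` and `n ≥ 1`,
`(1/(m+n)!)·Σ_{k=2}^{m} C(m, k)·(k−1)·k!·(m+n−k−1)! = m(m−1)/(n(n+1)(m+n))`. -/
theorem sum_factorial_identity_two (m n : ℕ) (hn : 1 ≤ n) :
    (1 / ((m + n).factorial : ℝ)) *
      ∑ k ∈ Finset.Icc 2 m,
        (m.choose k : ℝ) * ((k : ℝ) - 1) * (k.factorial : ℝ) * ((m + n - k - 1).factorial : ℝ)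
      = (m : ℝ) * ((m : ℝ) - 1) / ((n : ℝ) * ((n : ℝ) + 1) * ((m : ℝ) + (n : ℝ))) := by
  obtain ⟨p, rfl⟩ := Nat.exists_eq_add_of_le' hn
  rcases m with _ | N
  · simp
  have hsum : ∑ k ∈ Icc 2 (N + 1), ((N + 1).choose k : ℝ) * ((k : ℝ) - 1) * (k.factorial : ℝ) *
        ((N + 1 + (p + 1) - k - 1).factorial : ℝ) =
      ((N + 1).factorial : ℝ) *
        ∑ j ∈ range N, ((N : ℝ) - j) * (((p + j).factorial : ℝ) / (j.factorial : ℝ)) := by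
    rw [mul_sum]
    refine sum_nbij' (fun k => N + 1 - k) (fun j => N + 1 - j) ?_ ?_ ?_ ?_ ?_
    · intro k hk
      simp only [mem_Icc, mem_range] at *
      omega
    · intro j hj
      simp only [mem_Icc, mem_range] at *
      omega
    · intro k hk
      simp only [mem_Icc] at hk
      omega
    · intro j hj
      simp only [mem_range] at hj
      omega
    · intro k hk
      have hk' : k ≤ N + 1 := (mem_Icc.mp hk).2
      rw [show N + 1 + (p + 1) - k - 1 = p + (N + 1 - k) by omega,
        ← Nat.choose_mul_factorial_mul_factorial hk', Nat.cast_sub hk']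
      push_cast
      field_simp
      ring
  rw [hsum, sum_range_sub_mul_factorial_div,
    show N + 1 + (p + 1) = p + N + 1 + 1 by omega, Nat.factorial_succ (p + N + 1),
    Nat.factorial_succ (p + N), Nat.factorial_succ N]
  push_cast
  field_simp
  ring
end

section
/- For all integers N ≥ 5, it holds that (1/N!)·Σ_{m=2}^{N−3} Σ_{k=2}^{min(m, N−m−1)} T(N−1, k, m)·(k−1)·m!·(N−m−1)! = (N−3)(N−4)/(6N), where T(N, k, m) = (N/m)·C(m, k)·C(N−m−1, k−1) and C(a,b) denotes the binomial coefficient. -/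
open Finset

theorem sum_choose_add_two_mul_choose (j c : ℕ) :
    ∑ i ∈ range (min j c + 1), (j + 2).choose (i + 2) * c.choose i = (j + c + 2).choose j := by
  have vandermonde := Nat.add_choose_eq c (j + 2) j
  rw [Nat.sum_antidiagonal_eq_sum_range_succ (fun a b => c.choose a * (j + 2).choose b)]
    at vandermonde
  rw [show j + c + 2 = c + (j + 2) by omega, vandermonde]
  have hsub : range (min j c + 1) ⊆ range (j + 1) := by
    intro i
    simp only [mem_range]
    omega
  rw [← sum_subset hsub (f := fun i => c.choose i * (j + 2).choose (j - i))]
  · refine sum_congr rfl fun i hi => ?_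
    rw [mem_range] at hi
    rw [mul_comm, Nat.choose_symm_of_eq_add (show j + 2 = (i + 2) + (j - i) by omega)]
  · intro i hi hi'
    rw [mem_range] at hi hi'
    rw [Nat.choose_eq_zero_of_lt (by omega : c < i), zero_mul]

theorem sum_choose_mul_choose_mul_factorial (j c : ℕ) :
    ∑ k ∈ Icc 2 (min (j + 2) (c + 2)),
        (((j + c + 4 : ℕ) : ℝ) / ((j + 2 : ℕ) : ℝ)) * ((j + 2).choose k : ℝ) *
            ((c + 1).choose (k - 1) : ℝ) *
          ((k : ℝ) - 1) * ((j + 2).factorial : ℝ) * ((c + 2).factorial : ℝ)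
      = (j + c + 4) * (j + c + 2).factorial * ((j + 1) * (c + 1)) := by
  have hIcc : Icc 2 (min (j + 2) (c + 2)) = Ico (0 + 2) (min j c + 1 + 2) := by
    ext k
    simp only [mem_Icc, mem_Ico]
    omega
  rw [hIcc, ← sum_Ico_add', ← range_eq_Ico]
  have hterm : ∀ i ∈ range (min j c + 1),
      (((j + c + 4 : ℕ) : ℝ) / ((j + 2 : ℕ) : ℝ)) * ((j + 2).choose (i + 2) : ℝ) *
            ((c + 1).choose (i + 2 - 1) : ℝ) *
          (((i + 2 : ℕ) : ℝ) - 1) * ((j + 2).factorial : ℝ) * ((c + 2).factorial : ℝ)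
      = (j + c + 4) * (j + 1) * j.factorial * (c + 2).factorial * (c + 1) *
          (((j + 2).choose (i + 2) * c.choose i : ℕ) : ℝ) := by
    intro i _
    have habsorb : ((c : ℝ) + 1) * c.choose i = (c + 1).choose (i + 1) * (i + 1) := by
      exact_mod_cast Nat.add_one_mul_choose_eq c i
    have hj : (j : ℝ) + 2 ≠ 0 := by positivity
    rw [show i + 2 - 1 = i + 1 by omega, Nat.factorial_succ (j + 1), Nat.factorial_succ j]
    push_cast
    rw [show (j : ℝ) + 1 + 1 = j + 2 by ring]
    field_simp
    linear_combination (-(j + 2).choose (i + 2) : ℝ) * habsorb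
  rw [sum_congr rfl hterm, ← mul_sum, ← Nat.cast_sum, sum_choose_add_two_mul_choose]
  have hfact : ((j + c + 2).choose j : ℝ) * j.factorial * (c + 2).factorial
      = (j + c + 2).factorial := by
    have h := Nat.choose_mul_factorial_mul_factorial (show j ≤ j + c + 2 by omega)
    rw [show j + c + 2 - j = c + 2 by omega] at h
    exact_mod_cast h
  linear_combination ((j + c + 4) * (j + 1) * (c + 1) : ℝ) * hfact

theorem sum_range_add_one_mul_sub (x : ℝ) (M : ℕ) :
    ∑ j ∈ range M, ((j : ℝ) + 1) * (x - j)
      = x * (M * (M + 1)) / 2 - (M - 1) * M * (M + 1) / 3 := by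
  induction M with
  | zero => simp
  | succ M ih =>
    rw [sum_range_succ, ih]
    push_cast
    ring

/-- For all integers `N ≥ 5`,
`(1/N!)·Σ_{m=2}^{N−3} Σ_{k=2}^{min(m, N−m−1)} T(N−1, k, m)·(k−1)·m!·(N−m−1)!
  = (N−3)(N−4)/(6N)`,
where `T(N, k, m) = (N/m)·C(m, k)·C(N−m−1, k−1)`. -/
theorem sum_factorial_identity_three (N : ℕ) (hN : 5 ≤ N) :
    (1 / (N.factorial : ℝ)) *
      ∑ m ∈ Finset.Icc 2 (N - 3), ∑ k ∈ Finset.Icc 2 (min m (N - m - 1)),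
        (((N - 1 : ℕ) : ℝ) / (m : ℝ)) * (m.choose k : ℝ) *
            ((N - m - 2).choose (k - 1) : ℝ) *
          ((k : ℝ) - 1) * (m.factorial : ℝ) * ((N - m - 1).factorial : ℝ)
      = ((N : ℝ) - 3) * ((N : ℝ) - 4) / (6 * (N : ℝ)) := by
  obtain ⟨n, rfl⟩ := Nat.exists_eq_add_of_le' hN
  have hIcc : Icc 2 (n + 5 - 3) = Ico (0 + 2) (n + 1 + 2) := by
    ext m
    simp only [mem_Icc, mem_Ico]
    omega
  rw [hIcc, ← sum_Ico_add', ← range_eq_Ico]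
  have hinner : ∀ j ∈ range (n + 1),
      ∑ k ∈ Icc 2 (min (j + 2) (n + 5 - (j + 2) - 1)),
        (((n + 5 - 1 : ℕ) : ℝ) / ((j + 2 : ℕ) : ℝ)) * ((j + 2).choose k : ℝ) *
            ((n + 5 - (j + 2) - 2).choose (k - 1) : ℝ) *
          ((k : ℝ) - 1) * ((j + 2).factorial : ℝ) * ((n + 5 - (j + 2) - 1).factorial : ℝ)
      = (n + 4) * (n + 2).factorial * (((j : ℝ) + 1) * ((n + 1 : ℝ) - j)) := by
    intro j hj
    obtain ⟨c, rfl⟩ := Nat.exists_eq_add_of_le (Nat.lt_succ_iff.mp (mem_range.mp hj))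
    rw [show j + c + 5 - (j + 2) - 1 = c + 2 by omega,
      show j + c + 5 - (j + 2) - 2 = c + 1 by omega, show j + c + 5 - 1 = j + c + 4 by omega,
      sum_choose_mul_choose_mul_factorial]
    push_cast
    ring
  rw [sum_congr rfl hinner, ← mul_sum, sum_range_add_one_mul_sub, Nat.factorial_succ (n + 4),
    Nat.factorial_succ (n + 3), Nat.factorial_succ (n + 2)]
  have hfact : ((n + 2).factorial : ℝ) ≠ 0 := by positivity
  push_cast
  have h3 : (n : ℝ) + 2 + 1 ≠ 0 := by positivity
  have h4 : (n : ℝ) + 3 + 1 ≠ 0 := by positivity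
  have h5 : (n : ℝ) + 4 + 1 ≠ 0 := by positivity
  have h5' : (n : ℝ) + 5 ≠ 0 := by positivity
  field_simp
  ring
end

section
/- For every integer N ≥ 4, it holds that (1/N!)·(Σ_{k=0}^{N−4} C(N−4, k)·k!·(N−k−1)! + Σ_{k=0}^{N−5} C(N−4, k)·(k+2)!·(N−k−3)!) = 1/3 − 1/(N(N−1)), where C(a,b) denotes the binomial coefficient (the second sum is empty, hence zero, when N = 4). -/
open Finset

open Nat in
/-- A discrete Beta integral:
`∑_{i+j=n} C(n, i)·(i+a)!·(j+b)! = a!·b!·(n+a+b+1)!/(a+b+1)!`. -/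
theorem sum_antidiagonal_choose_mul_factorial_mul_factorial (n a b : ℕ) :
    (a + b + 1)! * ∑ p ∈ antidiagonal n, n.choose p.1 * ((p.1 + a)! * (p.2 + b)!) =
      a ! * b ! * (n + a + b + 1)! := by
  induction n generalizing a b with
  | zero => simp; ring
  | succ n ih =>
    have h := Finset.sum_antidiagonal_choose_succ_mul (R := ℕ) (fun i j => (i + a)! * (j + b)!) n
    simp only [Nat.cast_id] at h
    have h₁ := ih a (b + 1)
    have h₂ := ih (a + 1) b
    rw [show a + (b + 1) + 1 = a + b + 1 + 1 by ring,
      show n + a + (b + 1) + 1 = n + 1 + a + b + 1 by ring] at h₁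
    rw [show a + 1 + b + 1 = a + b + 1 + 1 by ring,
      show n + (a + 1) + b + 1 = n + 1 + a + b + 1 by ring] at h₂
    have hsymm : ∑ p ∈ antidiagonal n, n.choose p.2 * ((p.1 + 1 + a)! * (p.2 + b)!) =
        ∑ p ∈ antidiagonal n, n.choose p.1 * ((p.1 + (a + 1))! * (p.2 + b)!) := by
      refine sum_congr rfl fun p hp => ?_
      rw [← Nat.choose_symm_of_eq_add (mem_antidiagonal.1 hp).symm,
        add_right_comm p.1 1 a, add_assoc p.1 a 1]
    simp only [add_right_comm _ 1 b, ← add_assoc _ b 1] at h h₁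
    rw [h, hsymm]
    refine Nat.eq_of_mul_eq_mul_left (Nat.succ_pos (a + b + 1)) ?_
    rw [← mul_assoc, Nat.succ_eq_add_one, ← Nat.factorial_succ, mul_add, h₁, h₂,
      Nat.factorial_succ a, Nat.factorial_succ b]
    ring

open Nat in
/-- The real-valued form of `sum_antidiagonal_choose_mul_factorial_mul_factorial`, as a sum over
a range. -/
theorem sum_range_choose_mul_factorial_mul_factorial (n a b : ℕ) :
    ∑ k ∈ range (n + 1), (n.choose k : ℝ) * ((k + a)! : ℝ) * ((n - k + b)! : ℝ) =
      (a ! : ℝ) * b ! * (n + a + b + 1)! / (a + b + 1)! := by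
  rw [eq_div_iff (by positivity), mul_comm]
  have h := sum_antidiagonal_choose_mul_factorial_mul_factorial n a b
  rw [Nat.sum_antidiagonal_eq_sum_range_succ_mk] at h
  simp only [mul_assoc]
  simp only [mul_assoc] at h
  exact_mod_cast h

/-- For every integer `N ≥ 4`,
`(1/N!)·(Σ_{k=0}^{N−4} C(N−4, k)·k!·(N−k−1)! + Σ_{k=0}^{N−5} C(N−4, k)·(k+2)!·(N−k−3)!)
  = 1/3 − 1/(N(N−1))` (the second sum is empty when `N = 4`). -/
theorem sum_factorial_identity_five (N : ℕ) (hN : 4 ≤ N) :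
    (1 / (N.factorial : ℝ)) *
      ((∑ k ∈ Finset.range (N - 3),
          ((N - 4).choose k : ℝ) * (k.factorial : ℝ) * ((N - k - 1).factorial : ℝ)) +
        (∑ k ∈ Finset.range (N - 4),
          ((N - 4).choose k : ℝ) * ((k + 2).factorial : ℝ) * ((N - k - 3).factorial : ℝ)))
      = 1 / 3 - 1 / ((N : ℝ) * ((N : ℝ) - 1)) := by
  obtain ⟨n, rfl⟩ := Nat.exists_eq_add_of_le' hN
  have h₁ := sum_range_choose_mul_factorial_mul_factorial n 0 3
  have h₂ := sum_range_choose_mul_factorial_mul_factorial n 2 1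
  rw [sum_range_succ] at h₂
  have e₁ : ∑ k ∈ range (n + 1), (n.choose k : ℝ) * (k.factorial : ℝ) *
        ((n + 4 - k - 1).factorial : ℝ) =
      ∑ k ∈ range (n + 1), (n.choose k : ℝ) * ((k + 0).factorial : ℝ) *
        ((n - k + 3).factorial : ℝ) := by
    refine sum_congr rfl fun k hk => ?_
    rw [mem_range] at hk
    rw [show n + 4 - k - 1 = n - k + 3 by lia, add_zero]
  have e₂ : ∑ k ∈ range n, (n.choose k : ℝ) * ((k + 2).factorial : ℝ) *
        ((n + 4 - k - 3).factorial : ℝ) =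
      ∑ k ∈ range n, (n.choose k : ℝ) * ((k + 2).factorial : ℝ) *
        ((n - k + 1).factorial : ℝ) := by
    refine sum_congr rfl fun k hk => ?_
    rw [mem_range] at hk
    rw [show n + 4 - k - 3 = n - k + 1 by lia]
  rw [show n + 4 - 3 = n + 1 by lia, Nat.add_sub_cancel, e₁, e₂, h₁, eq_sub_of_add_eq h₂]
  have hn : (n : ℝ) + 4 - 1 ≠ 0 := by
    rw [add_sub_assoc]; norm_num; positivity
  have hfac : ((n + 4).factorial : ℝ) = (n + 4) * (n + 4 - 1) * (n + 2).factorial := by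
    rw [Nat.factorial_succ (n + 3), Nat.factorial_succ (n + 2)]
    push_cast
    ring
  simp only [add_zero, add_assoc, Nat.reduceAdd, Nat.choose_self, Nat.sub_self, hfac,
    show Nat.factorial 0 = 1 from rfl, show Nat.factorial 1 = 1 from rfl,
    show Nat.factorial 2 = 2 from rfl, show Nat.factorial 3 = 6 from rfl,
    show Nat.factorial 4 = 24 from rfl]
  push_cast
  field_simp
  ring
end
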